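/- Let X be a real-valued random variable with distribution function F having finite moments m_n = E[X^n] of all positive integer orders, such that F is absolutely continuous on ℝ \ (−x₀, x₀) for some x₀ > 1, with density f(x) = F′(x) > 0 there. Let a > 0 and α ∈ [0,1]. If limsup_{|x|→∞} f(x + a·sign(x)·(log|x|)^α) / f(x) < 1, then ∑_{n=1}^∞ m_{2n}^{−1/(2n)} = ∞ and F is uniquely determined by its moments among all probability distributions on ℝ; moreover, the distributions of X² and |X| are uniquely determined by their moments among all probability distributions on [0,∞). -/

import Mathlib

open MeasureTheory Filter Set

/-- `sgn x = 1` if `x ≥ 0` and `-1` if `x < 0`. -/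
noncomputable def sgn (x : ℝ) : ℝ := if 0 ≤ x then 1 else -1

/-- Moment-determinacy on `ℝ` among all probability distributions on `ℝ`. -/
def IsMomentDetOnReal (μ : Measure ℝ) : Prop :=
  ∀ ν : Measure ℝ, IsProbabilityMeasure ν →
    (∀ n : ℕ, 0 < n → Integrable (fun x => x ^ n) ν ∧
      ∫ x, x ^ n ∂ν = ∫ x, x ^ n ∂μ) → ν = μ

/-- Moment-determinacy on `ℝ₊` among all probability distributions on `[0,∞)`. -/
def IsMomentDetOnNonneg (μ : Measure ℝ) : Prop :=
  ∀ ν : Measure ℝ, IsProbabilityMeasure ν → ν (Set.Iio 0) = 0 →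
    (∀ n : ℕ, 0 < n → Integrable (fun x => x ^ n) ν ∧
      ∫ x, x ^ n ∂ν = ∫ x, x ^ n ∂μ) → ν = μ

section Quasianalytic

variable {E : Type*} [NormedAddCommGroup E] [NormedSpace ℝ E] {G : ℕ → ℝ → E} {r : ℕ → ℝ} {A : ℝ}

/-- Propagation of weighted derivative bounds to the right, the basic estimate in Bang's proof of
the Denjoy–Carleman theorem. -/
theorem norm_le_exp_of_hasDerivAt_succ (hG : ∀ n x, HasDerivAt (G n) (G (n + 1) x) x)
    (hr : Monotone r) (hr0 : ∀ n, 0 < r n) {x h B : ℝ} (hB : 0 ≤ B) {N : ℕ}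
    (hx : ∀ n ≤ N + 1, ‖G n x‖ ≤ B * Real.exp n * ∏ k ∈ Finset.range n, r k)
    (htop : ∀ y, ‖G (N + 1) y‖ ≤ B * Real.exp (N + 1 : ℕ) * ∏ k ∈ Finset.range (N + 1), r k)
    {n : ℕ} (hn : n ≤ N + 1) :
    ∀ y ∈ Icc x (x + h), ‖G n y‖ ≤
      B * Real.exp n * (∏ k ∈ Finset.range n, r k) * Real.exp (Real.exp 1 * r N * (y - x)) := by
  have hM (n : ℕ) : 0 < ∏ k ∈ Finset.range n, r k := Finset.prod_pos fun k _ => hr0 k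
  induction hn using Nat.decreasingInduction with
  | self =>
    intro y hy
    refine (htop y).trans (le_mul_of_one_le_right ?_ (Real.one_le_exp ?_))
    · have := hM (N + 1); positivity
    · have := hr0 N
      have := sub_nonneg.2 hy.1
      positivity
  | of_succ n hn ih =>
    refine image_norm_le_of_norm_deriv_right_le_deriv_boundary
      (B := fun y => B * Real.exp n * (∏ k ∈ Finset.range n, r k) *
        Real.exp (Real.exp 1 * r N * (y - x)))
      (B' := fun y => B * Real.exp n * (∏ k ∈ Finset.range n, r k) *
        (Real.exp (Real.exp 1 * r N * (y - x)) * (Real.exp 1 * r N)))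
      (fun y _ => (hG n y).continuousAt.continuousWithinAt)
      (fun y _ => (hG n y).hasDerivWithinAt) ?_ ?_ ?_
    · simpa using hx n (by omega)
    · intro y
      refine HasDerivAt.const_mul _ (HasDerivAt.exp ?_)
      simpa using ((hasDerivAt_id y).sub_const x).const_mul (Real.exp 1 * r N)
    · intro y hy
      refine (ih y ⟨hy.1, hy.2.le⟩).trans ?_
      have h1 : r n ≤ r N := hr (by omega)
      have := hM n
      rw [Finset.prod_range_succ, Nat.cast_succ, Real.exp_add]
      calc B * (Real.exp n * Real.exp 1) * ((∏ k ∈ Finset.range n, r k) * r n) *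
            Real.exp (Real.exp 1 * r N * (y - x))
          = B * Real.exp n * (∏ k ∈ Finset.range n, r k) *
            (Real.exp (Real.exp 1 * r N * (y - x)) * (Real.exp 1 * r n)) := by ring
        _ ≤ _ := by gcongr

theorem norm_le_exp_neg_of_norm_le_exp_neg_succ (hG : ∀ n x, HasDerivAt (G n) (G (n + 1) x) x)
    (hr : Monotone r) (hr0 : ∀ n, 0 < r n) (hA : 0 ≤ A)
    (hbound : ∀ n x, ‖G n x‖ ≤ A * ∏ k ∈ Finset.range n, r k) {N : ℕ} {x y : ℝ}
    (hx : ∀ n, ‖G n x‖ ≤ A * Real.exp (n - (N + 1 : ℕ)) * ∏ k ∈ Finset.range n, r k)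
    (hxy : x ≤ y) (hyx : y - x ≤ (Real.exp 1)⁻¹ * (r N)⁻¹) (n : ℕ) :
    ‖G n y‖ ≤ A * Real.exp (n - N) * ∏ k ∈ Finset.range n, r k := by
  have hM (n : ℕ) : 0 < ∏ k ∈ Finset.range n, r k := Finset.prod_pos fun k _ => hr0 k
  rcases le_total n (N + 1) with hn | hn
  · have key := norm_le_exp_of_hasDerivAt_succ hG hr hr0 (x := x) (h := y - x)
      (B := A * Real.exp (-(N + 1 : ℕ))) (by positivity) (N := N) ?_ ?_ hn y ⟨hxy, by linarith⟩
    · refine key.trans ?_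
      have h1 : Real.exp 1 * r N * (y - x) ≤ 1 := by
        have := hr0 N
        calc _ ≤ Real.exp 1 * r N * ((Real.exp 1)⁻¹ * (r N)⁻¹) := by gcongr
          _ = 1 := by field_simp
      calc _ ≤ A * Real.exp (-(N + 1 : ℕ)) * Real.exp n * (∏ k ∈ Finset.range n, r k) *
            Real.exp 1 := by have := hM n; gcongr
        _ = A * (Real.exp (-(N + 1 : ℕ)) * Real.exp n * Real.exp 1) *
            ∏ k ∈ Finset.range n, r k := by ring
        _ = _ := by
          rw [← Real.exp_add, ← Real.exp_add]
          push_cast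
          ring_nf
    · intro m _
      refine (hx m).trans_eq ?_
      rw [mul_assoc A (Real.exp _) (Real.exp _), ← Real.exp_add]
      ring_nf
    · intro z
      refine (hbound _ z).trans_eq ?_
      rw [mul_assoc A, ← Real.exp_add]
      simp
  · refine (hbound n y).trans ?_
    have := hM n
    gcongr
    refine le_mul_of_one_le_right hA (Real.one_le_exp ?_)
    have : ((N + 1 : ℕ) : ℝ) ≤ n := by exact_mod_cast hn
    push_cast at this
    linarith

/-- **Denjoy–Carleman theorem** (half-line version): a function with derivatives bounded by
`A * r 0 * ⋯ * r (n - 1)`, where `r` is monotone and `∑ 1 / r n = ∞`, vanishes to the right of any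
point at which it vanishes to infinite order. -/
theorem eq_zero_of_nonneg_of_not_summable_inv (hG : ∀ n x, HasDerivAt (G n) (G (n + 1) x) x)
    (hr : Monotone r) (hr0 : ∀ n, 0 < r n) (hsum : ¬ Summable fun n => (r n)⁻¹)
    (hbound : ∀ n x, ‖G n x‖ ≤ A * ∏ k ∈ Finset.range n, r k)
    (hzero : ∀ n, G n 0 = 0) {x : ℝ} (hx : 0 ≤ x) : G 0 x = 0 := by
  have hM (n : ℕ) : 0 < ∏ k ∈ Finset.range n, r k := Finset.prod_pos fun k _ => hr0 k
  have hA : 0 ≤ A := by simpa using (norm_nonneg _).trans (hbound 0 0)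
  have reach (K j : ℕ) : ∀ y, 0 ≤ y →
      y ≤ ∑ i ∈ Finset.range j, (Real.exp 1)⁻¹ * (r (K + i))⁻¹ →
      ∀ n, ‖G n y‖ ≤ A * Real.exp (n - K) * ∏ k ∈ Finset.range n, r k := by
    induction j generalizing K with
    | zero =>
      intro y hy0 hy n
      obtain rfl : y = 0 := le_antisymm (by simpa using hy) hy0
      rw [hzero, norm_zero]
      have := hM n
      positivity
    | succ j ih =>
      intro y hy0 hy
      set s := (Real.exp 1)⁻¹ * (r K)⁻¹ with hs
      have hs0 : 0 < s := by have := hr0 K; positivity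
      refine norm_le_exp_neg_of_norm_le_exp_neg_succ hG hr hr0 hA hbound (x := max 0 (y - s))
        (ih (K + 1) _ (le_max_left _ _) ?_) (max_le hy0 (by linarith)) ?_
      · rw [Finset.sum_range_succ'] at hy
        have e : ∀ i, K + 1 + i = K + (i + 1) := fun i => by omega
        simp only [e]
        refine max_le (Finset.sum_nonneg fun i _ => ?_) ?_
        · have := hr0 (K + (i + 1)); positivity
        · simp only [add_zero] at hy
          linarith
      · have := le_max_right 0 (y - s)
        linarith
  have small (K : ℕ) : ‖G 0 x‖ ≤ A * Real.exp (-(K : ℝ)) := by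
    have hns : ¬ Summable fun i => (Real.exp 1)⁻¹ * (r (K + i))⁻¹ := by
      rw [summable_mul_left_iff (by positivity)]
      simp_rw [add_comm K]
      rwa [summable_nat_add_iff (f := fun n => (r n)⁻¹)]
    have ht := (not_summable_iff_tendsto_nat_atTop_of_nonneg
      (fun i => by have := hr0 (K + i); positivity)).1 hns
    obtain ⟨j, hj⟩ := (ht.eventually_ge_atTop x).exists
    simpa using reach K j x hx hj 0
  have hlim : Tendsto (fun K : ℕ => A * Real.exp (-(K : ℝ))) atTop (nhds (A * 0)) :=
    (Real.tendsto_exp_neg_atTop_nhds_zero.comp tendsto_natCast_atTop_atTop).const_mul A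
  rw [mul_zero] at hlim
  exact norm_le_zero_iff.1 (ge_of_tendsto' hlim small)

/-- **Denjoy–Carleman theorem**: a function with derivatives bounded by `A * r 0 * ⋯ * r (n - 1)`,
where `r` is monotone and `∑ 1 / r n = ∞`, vanishes if it vanishes to infinite order at `0`. -/
theorem eq_zero_of_not_summable_inv (hG : ∀ n x, HasDerivAt (G n) (G (n + 1) x) x)
    (hr : Monotone r) (hr0 : ∀ n, 0 < r n) (hsum : ¬ Summable fun n => (r n)⁻¹)
    (hbound : ∀ n x, ‖G n x‖ ≤ A * ∏ k ∈ Finset.range n, r k)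
    (hzero : ∀ n, G n 0 = 0) (x : ℝ) : G 0 x = 0 := by
  rcases le_total 0 x with hx | hx
  · exact eq_zero_of_nonneg_of_not_summable_inv hG hr hr0 hsum hbound hzero hx
  · have key := eq_zero_of_nonneg_of_not_summable_inv (G := fun n y => (-1 : ℝ) ^ n • G n (-y))
      (fun n y => ?_) hr hr0 hsum (A := A) (fun n y => ?_) (fun n => ?_) (neg_nonneg.2 hx)
    · simpa using key
    · have := ((hG n (-y)).scomp y (hasDerivAt_neg y)).const_smul ((-1 : ℝ) ^ n)
      simpa [pow_succ, mul_smul, Function.comp_def, Pi.smul_def] using this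
    · simpa [norm_smul] using hbound n (-y)
    · simp [hzero]

end Quasianalytic

section Uniqueness

variable {μ ν : Measure ℝ} {r : ℕ → ℝ} {A C : ℝ}

theorem abs_pow_succ_le {t : ℝ} (ht : 0 < t) (x : ℝ) (k : ℕ) :
    |x| ^ (2 * k + 1) ≤ t * x ^ (2 * k) + x ^ (2 * (k + 1)) / t := by
  rw [← (even_two_mul k).pow_abs x, ← (even_two_mul (k + 1)).pow_abs x]
  have h1 : |x| ≤ t + |x| ^ 2 / t := by
    rw [← sub_nonneg]
    have : t + |x| ^ 2 / t - |x| = ((|x| - t / 2) ^ 2 + 3 / 4 * t ^ 2) / t := by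
      field_simp; ring
    rw [this]; positivity
  calc |x| ^ (2 * k + 1) = |x| ^ (2 * k) * |x| := pow_succ _ _
    _ ≤ |x| ^ (2 * k) * (t + |x| ^ 2 / t) := by gcongr
    _ = _ := by ring

theorem integral_abs_pow_le (hμ : ∀ n : ℕ, Integrable (fun x => x ^ n) μ) (hr0 : ∀ n, 0 < r n)
    (hC : ∀ n, r (n + 1) ≤ C * r n)
    (hbound : ∀ n, ∫ x, x ^ (2 * n) ∂μ ≤ A * ∏ k ∈ Finset.range (2 * n), r k) (n : ℕ) :
    ∫ x, |x| ^ n ∂μ ≤ A * (1 + C) * ∏ k ∈ Finset.range n, r k := by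
  have hM (n : ℕ) : 0 < ∏ k ∈ Finset.range n, r k := Finset.prod_pos fun k _ => hr0 k
  have hA : 0 ≤ A := by
    have h0 := hbound 0
    simp only [mul_zero, pow_zero, Finset.range_zero, Finset.prod_empty, mul_one] at h0
    exact (integral_nonneg fun _ => zero_le_one).trans h0
  have hC0 : 0 < C := pos_of_mul_pos_left ((hr0 1).trans_le (hC 0)) (hr0 0).le
  rcases Nat.even_or_odd' n with ⟨k, rfl | rfl⟩
  · simp only [(even_two_mul k).pow_abs]
    refine (hbound k).trans ?_
    have := hM (2 * k)
    gcongr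
    nlinarith
  · have hint : Integrable (fun x => r (2 * k) * x ^ (2 * k) + x ^ (2 * (k + 1)) / r (2 * k)) μ :=
      ((hμ _).const_mul _).add ((hμ _).div_const _)
    have hrk := hr0 (2 * k)
    calc ∫ x, |x| ^ (2 * k + 1) ∂μ
        ≤ ∫ x, (r (2 * k) * x ^ (2 * k) + x ^ (2 * (k + 1)) / r (2 * k)) ∂μ := by
          refine integral_mono_of_nonneg (Eventually.of_forall fun x => by positivity) hint
            (Eventually.of_forall fun x => abs_pow_succ_le hrk x k)
      _ = r (2 * k) * ∫ x, x ^ (2 * k) ∂μ + (∫ x, x ^ (2 * (k + 1)) ∂μ) / r (2 * k) := by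
          rw [integral_add ((hμ _).const_mul _) ((hμ _).div_const _), integral_const_mul,
            integral_div]
      _ ≤ r (2 * k) * (A * ∏ k ∈ Finset.range (2 * k), r k) +
          (A * ∏ k ∈ Finset.range (2 * (k + 1)), r k) / r (2 * k) := by
          gcongr
          · exact hbound k
          · exact hbound (k + 1)
      _ = A * (∏ k ∈ Finset.range (2 * k), r k) * (r (2 * k) + r (2 * k + 1)) := by
          rw [show 2 * (k + 1) = 2 * k + 1 + 1 by ring, Finset.prod_range_succ _ (2 * k + 1),
            Finset.prod_range_succ _ (2 * k)]
          field_simp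
      _ ≤ A * (∏ k ∈ Finset.range (2 * k), r k) * (r (2 * k) + C * r (2 * k)) := by
          have := hM (2 * k)
          gcongr
          exact hC _
      _ = _ := by rw [Finset.prod_range_succ _ (2 * k)]; ring

theorem memLp_id_natCast [IsFiniteMeasure μ] (hμ : ∀ n : ℕ, Integrable (fun x => x ^ n) μ)
    (n : ℕ) : MemLp id n μ := by
  rcases eq_or_ne n 0 with rfl | hn
  · simpa using aestronglyMeasurable_id
  · refine (integrable_norm_rpow_iff aestronglyMeasurable_id (by simpa) (by simp)).1 ?_
    simpa using (hμ n).norm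

theorem norm_iteratedDeriv_charFun_le [IsFiniteMeasure μ]
    (hμ : ∀ n : ℕ, Integrable (fun x => x ^ n) μ) (n : ℕ) (t : ℝ) :
    ‖iteratedDeriv n (charFun μ) t‖ ≤ ∫ x, |x| ^ n ∂μ := by
  rw [iteratedDeriv_charFun (memLp_id_natCast hμ n), norm_mul, norm_pow, Complex.norm_I, one_pow,
    one_mul]
  refine (norm_integral_le_integral_norm _).trans_eq (integral_congr_ae (.of_forall fun x => ?_))
  have : Complex.exp (t * x * Complex.I) = Complex.exp ((t * x : ℝ) * Complex.I) := by
    push_cast; rfl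
  simp [this, Complex.norm_exp_ofReal_mul_I]

theorem hasDerivAt_iteratedDeriv_charFun [IsFiniteMeasure μ]
    (hμ : ∀ n : ℕ, Integrable (fun x => x ^ n) μ) (n : ℕ) (t : ℝ) :
    HasDerivAt (iteratedDeriv n (charFun μ)) (iteratedDeriv (n + 1) (charFun μ) t) t := by
  have h : ContDiff ℝ (n + 1 : ℕ) (charFun μ) := contDiff_charFun (memLp_id_natCast hμ (n + 1))
  rw [iteratedDeriv_succ]
  exact (h.differentiable_iteratedDeriv n (by exact_mod_cast n.lt_succ_self) t).hasDerivAt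

/-- **Carleman's criterion**: two finite measures with the same moments coincide if the even moments
are bounded by `A * r 0 * ⋯ * r (2 n - 1)` with `r` monotone and `∑ 1 / r n = ∞`. -/
theorem eq_of_integral_pow_eq [IsFiniteMeasure μ] [IsFiniteMeasure ν]
    (hμ : ∀ n : ℕ, Integrable (fun x => x ^ n) μ) (hν : ∀ n : ℕ, Integrable (fun x => x ^ n) ν)
    (heq : ∀ n : ℕ, ∫ x, x ^ n ∂μ = ∫ x, x ^ n ∂ν)
    (hr : Monotone r) (hr0 : ∀ n, 0 < r n) (hC : ∀ n, r (n + 1) ≤ C * r n)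
    (hsum : ¬ Summable fun n => (r n)⁻¹)
    (hbound : ∀ n, ∫ x, x ^ (2 * n) ∂μ ≤ A * ∏ k ∈ Finset.range (2 * n), r k) : μ = ν := by
  refine Measure.ext_of_charFun (funext fun t => sub_eq_zero.1 ?_)
  have hμM := integral_abs_pow_le hμ hr0 hC hbound
  have hνM := integral_abs_pow_le hν hr0 hC fun n => (heq _) ▸ hbound n
  have key := eq_zero_of_not_summable_inv (A := A * (1 + C) + A * (1 + C))
    (G := fun n t => iteratedDeriv n (charFun μ) t - iteratedDeriv n (charFun ν) t)
    (fun n t => (hasDerivAt_iteratedDeriv_charFun hμ n t).sub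
      (hasDerivAt_iteratedDeriv_charFun hν n t)) hr hr0 hsum (fun n t => ?_) (fun n => ?_) t
  · simpa using key
  · refine (norm_sub_le _ _).trans ?_
    rw [add_mul]
    exact add_le_add ((norm_iteratedDeriv_charFun_le hμ n t).trans (hμM n))
      ((norm_iteratedDeriv_charFun_le hν n t).trans (hνM n))
  · have e := heq n
    rw [iteratedDeriv_charFun_zero (memLp_id_natCast hμ n),
      iteratedDeriv_charFun_zero (memLp_id_natCast hν n)]
    simp [e]

end Uniqueness

section Tail

variable {a α : ℝ}

theorem rpow_log_le_log (hα : α ∈ Icc (0 : ℝ) 1) {x : ℝ} (hx : Real.exp 1 ≤ x) :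
    Real.log x ^ α ≤ Real.log x := by
  have h1 : 1 ≤ Real.log x := (Real.le_log_iff_exp_le ((Real.exp_pos 1).trans_le hx)).2 hx
  simpa using Real.rpow_le_rpow_of_exponent_le h1 hα.2

theorem le_add_mul_rpow_log (ha : 0 < a) {x : ℝ} (hx : Real.exp 1 ≤ x) :
    x ≤ x + a * Real.log x ^ α := by
  have h1 : 1 ≤ Real.log x := (Real.le_log_iff_exp_le ((Real.exp_pos 1).trans_le hx)).2 hx
  have : 0 ≤ Real.log x ^ α := by positivity
  nlinarith

theorem exp_div_log_shift_le (ha : 0 < a) (hα : α ∈ Icc (0 : ℝ) 1) {c x : ℝ} (hc : 0 < c)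
    (hx : Real.exp 1 ≤ x) :
    Real.exp (c * (x + a * Real.log x ^ α) / Real.log (x + a * Real.log x ^ α)) ≤
      Real.exp (c * a) * Real.exp (c * x / Real.log x) := by
  have hx0 : 0 < x := (Real.exp_pos 1).trans_le hx
  have h1 : 1 ≤ Real.log x := (Real.le_log_iff_exp_le hx0).2 hx
  have hT := le_add_mul_rpow_log (α := α) ha hx
  rw [← Real.exp_add, Real.exp_le_exp]
  calc c * (x + a * Real.log x ^ α) / Real.log (x + a * Real.log x ^ α)
      ≤ c * (x + a * Real.log x ^ α) / Real.log x := by gcongr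
    _ ≤ c * (x + a * Real.log x) / Real.log x := by gcongr; exact rpow_log_le_log hα hx
    _ = c * a + c * x / Real.log x := by field_simp; ring

theorem lintegral_exp_div_log_shift_le {f : ℝ → ℝ} {R S ρ : ℝ} (ha : 0 < a)
    (hα : α ∈ Icc (0 : ℝ) 1) (hR : Real.exp 1 ≤ R) (hρ : 0 ≤ ρ)
    (hf : ∀ x ≥ R, 0 < f x ∧ f (x + a * Real.log x ^ α) ≤ ρ * f x) :
    ∫⁻ x in Icc (R + a * Real.log R ^ α) S,
        ENNReal.ofReal (Real.exp (R⁻¹ * x / Real.log x) * f x) ≤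
      ENNReal.ofReal (Real.exp (2 * a * R⁻¹) * ρ) *
        ∫⁻ x in Icc R S, ENNReal.ofReal (Real.exp (R⁻¹ * x / Real.log x) * f x) := by
  rcases lt_or_ge S R with hRS | hRS
  · have := le_add_mul_rpow_log (α := α) ha hR
    rw [Icc_eq_empty (by linarith)]
    simp
  have hR0 : 0 < R := (Real.exp_pos 1).trans_le hR
  have hlog {x : ℝ} (hx : R ≤ x) : 1 ≤ Real.log x :=
    (Real.le_log_iff_exp_le (hR0.trans_le hx)).2 (hR.trans hx)
  set T : ℝ → ℝ := fun x => x + a * Real.log x ^ α with hT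
  set T' : ℝ → ℝ := fun x => 1 + a * (x⁻¹ * α * Real.log x ^ (α - 1)) with hT'
  have hder {x : ℝ} (hx : R ≤ x) : HasDerivAt T (T' x) x := by
    have h1 := hlog hx
    exact (hasDerivAt_id x).add (((Real.hasDerivAt_log (hR0.trans_le hx).ne').rpow_const
      (.inl (by positivity))).const_mul a)
  have hmono : StrictMonoOn T (Icc R S) := by
    intro x hx y hy hxy
    have h1 := hlog hx.1
    have h2 : Real.log x ^ α ≤ Real.log y ^ α :=
      Real.rpow_le_rpow (by positivity)
        (Real.log_le_log (hR0.trans_le hx.1) hxy.le) hα.1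
    simp only [hT]
    nlinarith
  have hsub : Icc (T R) S ⊆ T '' Icc R S := by
    refine (Icc_subset_Icc_right (le_add_mul_rpow_log ha (hR.trans hRS))).trans
      (intermediate_value_Icc hRS fun x hx => ?_)
    exact (hder hx.1).continuousAt.continuousWithinAt
  refine (lintegral_mono_set hsub).trans ?_
  rw [lintegral_image_eq_lintegral_abs_deriv_mul measurableSet_Icc
    (fun x hx => (hder hx.1).hasDerivWithinAt) hmono.injOn,
    ← lintegral_const_mul' _ _ ENNReal.ofReal_ne_top]
  refine setLIntegral_mono' measurableSet_Icc fun x hx => ?_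
  rw [← ENNReal.ofReal_mul (abs_nonneg _), ← ENNReal.ofReal_mul (by positivity)]
  refine ENNReal.ofReal_le_ofReal ?_
  have hx0 := hR0.trans_le hx.1
  have h1 := hlog hx.1
  have hT'0 : 0 ≤ T' x := by
    have := hα.1
    positivity
  have hT'1 : T' x ≤ Real.exp (a * R⁻¹) := by
    have h2 : Real.log x ^ (α - 1) ≤ 1 :=
      Real.rpow_le_one_of_one_le_of_nonpos h1 (by linarith [hα.2])
    calc T' x ≤ 1 + a * (R⁻¹ * 1 * 1) := by
          have := hα.1
          have := hα.2
          simp only [hT']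
          gcongr
          exact hx.1
      _ ≤ Real.exp (a * R⁻¹) := by linarith [Real.add_one_le_exp (a * R⁻¹)]
  obtain ⟨hfx, hfT⟩ := hf x hx.1
  rw [abs_of_nonneg hT'0]
  calc T' x * (Real.exp (R⁻¹ * T x / Real.log (T x)) * f (T x))
      ≤ Real.exp (a * R⁻¹) *
          ((Real.exp (R⁻¹ * a) * Real.exp (R⁻¹ * x / Real.log x)) * (ρ * f x)) := by
        have hfT0 : 0 ≤ f (T x) :=
          (hf _ (hx.1.trans (le_add_mul_rpow_log ha (hR.trans hx.1)))).1.le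
        gcongr
        exact exp_div_log_shift_le ha hα (inv_pos.2 hR0) (hR.trans hx.1)
    _ = (Real.exp (a * R⁻¹) * Real.exp (R⁻¹ * a)) * ρ *
          (Real.exp (R⁻¹ * x / Real.log x) * f x) := by ring
    _ = _ := by
        rw [← Real.exp_add]
        ring_nf

/-- A density with `f (x + a (log x) ^ α) ≤ ρ f x` for large `x`, where `ρ < 1`, integrates
`exp (c x / log x)` near infinity for some `c > 0`. -/
theorem exists_lintegral_exp_div_log_lt_top {f : ℝ → ℝ} {x₀ ρ : ℝ} (ha : 0 < a)
    (hα : α ∈ Icc (0 : ℝ) 1) (hρ : 0 ≤ ρ) (hρ1 : ρ < 1)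
    (hfin : ∫⁻ x in Ici x₀, ENNReal.ofReal (f x) < ⊤)
    (hf : ∀ᶠ x in atTop, 0 < f x ∧ f (x + a * Real.log x ^ α) ≤ ρ * f x) :
    ∃ c > 0, ∃ R ≥ x₀,
      ∫⁻ x in Ici R, ENNReal.ofReal (Real.exp (c * x / Real.log x) * f x) < ⊤ := by
  have hlim : Tendsto (fun R : ℝ => Real.exp (2 * a * R⁻¹) * ρ) atTop (nhds ρ) := by
    have := ((Real.continuous_exp.tendsto _).comp
      (tendsto_inv_atTop_zero.const_mul (2 * a))).mul_const ρ
    simpa [Function.comp_def] using this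
  obtain ⟨R, hRf, hRθ, hRe, hRx⟩ := ((eventually_forall_ge_atTop.2 hf).and
    ((hlim.eventually_lt_const hρ1).and
      ((eventually_ge_atTop (Real.exp 1)).and (eventually_ge_atTop x₀)))).exists
  set θ := Real.exp (2 * a * R⁻¹) * ρ with hθ
  have hθ0 : 0 ≤ θ := by positivity
  have hR0 : 0 < R := (Real.exp_pos 1).trans_le hRe
  refine ⟨R⁻¹, inv_pos.2 hR0, R, hRx, ?_⟩
  set g : ℝ → ENNReal := fun x => ENNReal.ofReal (Real.exp (R⁻¹ * x / Real.log x) * f x) with hg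
  have hloc (S : ℝ) : ∫⁻ x in Icc R S, g x < ⊤ := by
    calc ∫⁻ x in Icc R S, g x
        ≤ ∫⁻ x in Icc R S, ENNReal.ofReal (Real.exp (R⁻¹ * S)) * ENNReal.ofReal (f x) := by
          refine setLIntegral_mono' measurableSet_Icc fun x hx => ?_
          rw [← ENNReal.ofReal_mul (by positivity)]
          have h1 : 1 ≤ Real.log x :=
            (Real.le_log_iff_exp_le (hR0.trans_le hx.1)).2 (hRe.trans hx.1)
          have h2 := (hRf x hx.1).1
          have h3 := hR0.trans_le hx.1
          refine ENNReal.ofReal_le_ofReal ?_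
          gcongr
          calc R⁻¹ * x / Real.log x ≤ R⁻¹ * x / 1 := by gcongr
            _ ≤ R⁻¹ * S := by rw [div_one]; gcongr; exact hx.2
      _ = ENNReal.ofReal (Real.exp (R⁻¹ * S)) * ∫⁻ x in Icc R S, ENNReal.ofReal (f x) :=
          lintegral_const_mul' _ _ ENNReal.ofReal_ne_top
      _ < ⊤ := ENNReal.mul_lt_top ENNReal.ofReal_lt_top
          ((lintegral_mono_set fun x hx => hRx.trans hx.1).trans_lt hfin)
  set T := R + a * Real.log R ^ α with hT
  have hbd (S : ℝ) : ∫⁻ x in Icc R S, g x ≤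
      ENNReal.ofReal ((∫⁻ x in Icc R T, g x).toReal / (1 - θ)) := by
    have hsub : Icc R S ⊆ Icc R T ∪ Icc T S := fun x hx =>
      (le_total x T).imp (fun h => ⟨hx.1, h⟩) fun h => ⟨h, hx.2⟩
    have hstep : ∫⁻ x in Icc R S, g x ≤
        (∫⁻ x in Icc R T, g x) + ENNReal.ofReal θ * ∫⁻ x in Icc R S, g x :=
      ((lintegral_mono_set hsub).trans (lintegral_union_le _ _ _)).trans
        (add_le_add_right (lintegral_exp_div_log_shift_le ha hα hRe hρ hRf) _)
    have hreal := ENNReal.toReal_mono (ENNReal.add_ne_top.2 ⟨(hloc T).ne,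
      ENNReal.mul_ne_top ENNReal.ofReal_ne_top (hloc S).ne⟩) hstep
    rw [ENNReal.toReal_add (hloc T).ne (ENNReal.mul_ne_top ENNReal.ofReal_ne_top (hloc S).ne),
      ENNReal.toReal_mul, ENNReal.toReal_ofReal hθ0] at hreal
    rw [← ENNReal.ofReal_toReal (hloc S).ne]
    refine ENNReal.ofReal_le_ofReal ?_
    rw [le_div_iff₀ (by linarith)]
    linarith
  have hunion : Ici R = ⋃ n : ℕ, Icc R n := by
    ext x
    simp only [mem_Ici, mem_iUnion, mem_Icc, exists_and_left, iff_self_and]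
    exact fun _ => exists_nat_ge x
  rw [hunion, setLIntegral_iUnion_of_directed _
    (Monotone.directed_le fun m n hmn => Icc_subset_Icc_right (Nat.cast_le.2 hmn))]
  exact (iSup_le fun n : ℕ => hbd n).trans_lt ENNReal.ofReal_lt_top

/-- For large `x` the power `x ^ n` is dominated by `exp (c x / log x)` up to a factor of order
`n! (log n) ^ n`. -/
theorem eventually_pow_le_exp_div_log {c : ℝ} (hc : 0 < c) : ∀ᶠ x : ℝ in atTop, ∀ n : ℕ,
    x ^ n ≤ (1 + (2 / c) ^ n * (n.factorial * Real.log (n + 3) ^ n)) *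
      Real.exp (c * x / Real.log x) := by
  have ho : ∀ᶠ x : ℝ in atTop, Real.log x ^ 2 ≤ c / 4 * x := by
    have := (Real.isLittleO_pow_log_id_atTop (n := 2)).bound (show 0 < c / 4 by positivity)
    filter_upwards [this, eventually_ge_atTop 0] with x hx hx0
    simpa [abs_of_nonneg hx0] using hx
  have hsqrt : ∀ᶠ x : ℝ in atTop, Real.log x ^ 2 ≤ c * √x := by
    filter_upwards [Real.tendsto_sqrt_atTop.eventually ho, eventually_ge_atTop 0] with x hx hx0
    rw [Real.log_sqrt hx0] at hx
    linarith
  filter_upwards [hsqrt, eventually_ge_atTop (Real.exp 1)] with x hx hxe n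
  have hx0 : 0 < x := (Real.exp_pos 1).trans_le hxe
  have h1 : 1 ≤ Real.log x := (Real.le_log_iff_exp_le hx0).2 hxe
  have hL : 0 < Real.log ((n : ℝ) + 3) := Real.log_pos (by linarith [n.cast_nonneg (α := ℝ)])
  rw [add_mul, one_mul]
  rcases le_total (n : ℝ) √x with hn | hn
  · refine le_add_of_le_of_nonneg ?_ (by positivity)
    rw [← Real.exp_log hx0, ← Real.exp_nat_mul, Real.exp_log hx0, Real.exp_le_exp,
      le_div_iff₀ (by positivity)]
    calc n * Real.log x * Real.log x = n * Real.log x ^ 2 := by ring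
      _ ≤ √x * (c * √x) := by gcongr
      _ = c * x := by rw [mul_left_comm, Real.mul_self_sqrt hx0.le]
  · refine le_add_of_nonneg_of_le (by positivity) ?_
    have hlogx : Real.log x ≤ 2 * Real.log (n + 3) := by
      have : Real.log √x ≤ Real.log (n + 3) :=
        Real.log_le_log (Real.sqrt_pos.2 hx0) (by linarith)
      rw [Real.log_sqrt hx0.le] at this
      linarith
    have hpow := Real.pow_div_factorial_le_exp (c * x / Real.log x) (by positivity) n
    rw [div_le_iff₀ (by positivity)] at hpow
    calc x ^ n = (Real.log x / c) ^ n * (c * x / Real.log x) ^ n := by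
          rw [← mul_pow]; congr 1; field_simp
      _ ≤ (2 * Real.log (n + 3) / c) ^ n * (Real.exp (c * x / Real.log x) * n.factorial) := by
          gcongr
      _ = _ := by rw [mul_div_right_comm, mul_pow]; ring

theorem one_le_log_natCast_add_three (n : ℕ) : 1 ≤ Real.log ((n : ℝ) + 3) := by
  rw [Real.le_log_iff_exp_le (by positivity)]
  linarith [Real.exp_one_lt_three, n.cast_nonneg (α := ℝ)]

theorem one_le_factorial_mul_log_pow (n : ℕ) :
    1 ≤ (n.factorial : ℝ) * Real.log ((n : ℝ) + 3) ^ n :=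
  one_le_mul_of_one_le_of_one_le (by exact_mod_cast n.factorial_pos)
    (one_le_pow₀ (one_le_log_natCast_add_three n))

/-- A finite measure whose density on a right half-line satisfies the ratio condition has one-sided
absolute moments of order at most `D ^ n n! (log n) ^ n`. -/
theorem exists_setLIntegral_pow_le {μ : Measure ℝ} [IsFiniteMeasure μ] {f : ℝ → ℝ} {x₀ ρ : ℝ}
    (hfm : Measurable f) (ha : 0 < a) (hα : α ∈ Icc (0 : ℝ) 1) (hρ : 0 ≤ ρ) (hρ1 : ρ < 1)
    (hμ : μ.restrict (Ici x₀) =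
      (volume.restrict (Ici x₀)).withDensity fun x => ENNReal.ofReal (f x))
    (hf : ∀ᶠ x in atTop, 0 < f x ∧ f (x + a * Real.log x ^ α) ≤ ρ * f x) :
    ∃ A D : ℝ, 0 ≤ A ∧ 1 ≤ D ∧ ∀ n : ℕ, ∫⁻ x in Ici 0, ENNReal.ofReal (x ^ n) ∂μ ≤
      ENNReal.ofReal (A * (D ^ n * (n.factorial * Real.log (n + 3) ^ n))) := by
  have hfin : ∫⁻ x in Ici x₀, ENNReal.ofReal (f x) < ⊤ := by
    have : μ.restrict (Ici x₀) univ < ⊤ := measure_lt_top _ _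
    simpa [hμ, withDensity_apply] using this
  obtain ⟨c, hc, R, hRx, hR⟩ := exists_lintegral_exp_div_log_lt_top ha hα hρ hρ1 hfin hf
  obtain ⟨R', hR', hRR', hR'1⟩ := ((eventually_forall_ge_atTop.2
    (eventually_pow_le_exp_div_log hc)).and
    ((eventually_ge_atTop R).and (eventually_ge_atTop 1))).exists
  set W := ∫⁻ x in Ici R', ENNReal.ofReal (Real.exp (c * x / Real.log x)) ∂μ with hW
  have hWfin : W < ⊤ := by
    have hsub : Ici R' ⊆ Ici x₀ := Ici_subset_Ici.2 (hRx.trans hRR')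
    have : μ.restrict (Ici R') =
        (volume.restrict (Ici R')).withDensity fun x => ENNReal.ofReal (f x) := by
      rw [← Measure.restrict_restrict_of_subset hsub, hμ, restrict_withDensity measurableSet_Ici,
        Measure.restrict_restrict_of_subset hsub]
    rw [hW, this, lintegral_withDensity_eq_lintegral_mul _ (by fun_prop) (by fun_prop)]
    refine lt_of_le_of_lt ?_ hR
    refine (lintegral_mono_set (Ici_subset_Ici.2 hRR')).trans_eq (lintegral_congr fun x => ?_)
    rw [Pi.mul_apply, mul_comm, ENNReal.ofReal_mul (by positivity)]
  refine ⟨μ.real univ + 2 * W.toReal, max R' (2 / c), by positivity, le_max_of_le_left hR'1,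
    fun n => ?_⟩
  set D := max R' (2 / c) with hD
  set q := (n.factorial : ℝ) * Real.log (n + 3) ^ n with hq
  have hq1 : 1 ≤ q := one_le_factorial_mul_log_pow n
  have hD1 : 1 ≤ D := le_max_of_le_left hR'1
  have hDn : 1 ≤ D ^ n := one_le_pow₀ hD1
  have hsub : Ici (0 : ℝ) ⊆ Icc 0 R' ∪ Ici R' := fun x hx =>
    (le_total x R').imp (fun h => ⟨hx, h⟩) fun h => h
  calc ∫⁻ x in Ici 0, ENNReal.ofReal (x ^ n) ∂μ
      ≤ (∫⁻ x in Icc 0 R', ENNReal.ofReal (x ^ n) ∂μ) +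
          ∫⁻ x in Ici R', ENNReal.ofReal (x ^ n) ∂μ :=
        (lintegral_mono_set hsub).trans (lintegral_union_le _ _ _)
    _ ≤ (∫⁻ x, ENNReal.ofReal (D ^ n * q) ∂μ) +
          ∫⁻ x in Ici R', ENNReal.ofReal (2 * (D ^ n * q)) *
            ENNReal.ofReal (Real.exp (c * x / Real.log x)) ∂μ := by
        refine add_le_add ((setLIntegral_mono' measurableSet_Icc fun x hx => ?_).trans
          (setLIntegral_le_lintegral _ _)) (setLIntegral_mono' measurableSet_Ici fun x hx => ?_)
        · refine ENNReal.ofReal_le_ofReal ?_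
          have : x ^ n ≤ D ^ n := pow_le_pow_left₀ hx.1 (hx.2.trans (le_max_left _ _)) n
          nlinarith
        · rw [← ENNReal.ofReal_mul (by positivity)]
          refine ENNReal.ofReal_le_ofReal ((hR' x hx n).trans ?_)
          have h2 : (2 / c) ^ n ≤ D ^ n := pow_le_pow_left₀ (by positivity) (le_max_right _ _) n
          gcongr
          nlinarith
    _ = ENNReal.ofReal (D ^ n * q) * μ univ + ENNReal.ofReal (2 * (D ^ n * q)) * W := by
        rw [lintegral_const, lintegral_const_mul' _ _ ENNReal.ofReal_ne_top]
    _ = ENNReal.ofReal (D ^ n * q) * ENNReal.ofReal (μ.real univ) +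
          ENNReal.ofReal (2 * (D ^ n * q)) * ENNReal.ofReal W.toReal := by
        rw [ENNReal.ofReal_toReal hWfin.ne, ofReal_measureReal]
    _ = _ := by
        rw [← ENNReal.ofReal_mul (by positivity), ← ENNReal.ofReal_mul (by positivity),
          ← ENNReal.ofReal_add (by positivity) (by positivity)]
        ring_nf

end Tail

section LogRate

variable {D A : ℝ}

theorem log_pow_succ_le (n : ℕ) : Real.log ((n : ℝ) + 4) ^ (n + 1) ≤
    Real.exp 1 * Real.log ((n : ℝ) + 3) ^ n * Real.log ((n : ℝ) + 4) := by
  have hL := one_le_log_natCast_add_three n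
  have hn := n.cast_nonneg (α := ℝ)
  have hL4 : 0 ≤ Real.log ((n : ℝ) + 4) := Real.log_nonneg (by linarith)
  have hstep : Real.log ((n : ℝ) + 4) ≤ Real.log (n + 3) * (1 + 1 / (n + 3)) := by
    have h1 := Real.log_le_sub_one_of_pos (show 0 < ((n : ℝ) + 4) / (n + 3) by positivity)
    rw [Real.log_div (by positivity) (by positivity)] at h1
    have h2 : ((n : ℝ) + 4) / (n + 3) - 1 = 1 / (n + 3) := by field_simp; ring
    have h3 : 0 < 1 / ((n : ℝ) + 3) := by positivity
    nlinarith
  rw [pow_succ]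
  gcongr
  calc Real.log ((n : ℝ) + 4) ^ n ≤ (Real.log (n + 3) * (1 + 1 / (n + 3))) ^ n := by gcongr
    _ ≤ (Real.log (n + 3) * Real.exp (1 / (n + 3))) ^ n := by
        gcongr
        linarith [Real.add_one_le_exp (1 / ((n : ℝ) + 3))]
    _ = Real.exp (n * (1 / (n + 3))) * Real.log (n + 3) ^ n := by
        rw [mul_pow, ← Real.exp_nat_mul, mul_comm]
    _ ≤ Real.exp 1 * Real.log (n + 3) ^ n := by
        gcongr
        rw [mul_one_div, div_le_one (by positivity)]
        linarith

theorem pow_mul_factorial_mul_log_pow_le (hD : 0 < D) (n : ℕ) :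
    D ^ n * (n.factorial * Real.log ((n : ℝ) + 3) ^ n) ≤
      ∏ k ∈ Finset.range n, D * Real.exp 1 * ((k + 1) * Real.log ((k : ℝ) + 4)) := by
  induction n with
  | zero => simp
  | succ n ih =>
    have hn := n.cast_nonneg (α := ℝ)
    have hL4 : 0 ≤ Real.log ((n : ℝ) + 4) := Real.log_nonneg (by linarith)
    have h := log_pow_succ_le n
    rw [Finset.prod_range_succ, Nat.factorial_succ]
    push_cast
    rw [show (n : ℝ) + 1 + 3 = n + 4 by ring]
    calc D ^ (n + 1) * ((n + 1) * n.factorial * Real.log ((n : ℝ) + 4) ^ (n + 1))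
        ≤ D ^ (n + 1) * ((n + 1) * n.factorial *
          (Real.exp 1 * Real.log ((n : ℝ) + 3) ^ n * Real.log ((n : ℝ) + 4))) := by gcongr
      _ = D ^ n * (n.factorial * Real.log ((n : ℝ) + 3) ^ n) *
          (D * Real.exp 1 * ((n + 1) * Real.log ((n : ℝ) + 4))) := by ring
      _ ≤ _ := by gcongr

theorem tendsto_sum_inv_mul_log_atTop :
    Tendsto (fun N : ℕ => ∑ k ∈ Finset.range N, (((k : ℝ) + 1) * Real.log ((k : ℝ) + 4))⁻¹)
      atTop atTop := by
  have hle (N : ℕ) : Real.log (Real.log ((N : ℝ) + 4)) - Real.log (Real.log 4) ≤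
      ∑ k ∈ Finset.range N, (((k : ℝ) + 1) * Real.log ((k : ℝ) + 4))⁻¹ := by
    have htel := Finset.sum_range_sub (fun k : ℕ => Real.log (Real.log ((k : ℝ) + 4))) N
    simp only [Nat.cast_zero, zero_add] at htel
    rw [← htel]
    refine Finset.sum_le_sum fun k _ => ?_
    have hk := k.cast_nonneg (α := ℝ)
    have hL : 0 < Real.log ((k : ℝ) + 4) := Real.log_pos (by linarith)
    have hL' : 0 < Real.log (((k + 1 : ℕ) : ℝ) + 4) := Real.log_pos (by push_cast; linarith)
    have h1 := Real.log_le_sub_one_of_pos (div_pos hL' hL)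
    rw [Real.log_div hL'.ne' hL.ne'] at h1
    have h2 := Real.log_le_sub_one_of_pos
      (show 0 < (((k + 1 : ℕ) : ℝ) + 4) / (k + 4) by positivity)
    rw [Real.log_div (by positivity) (by positivity)] at h2
    refine h1.trans ?_
    calc Real.log (((k + 1 : ℕ) : ℝ) + 4) / Real.log ((k : ℝ) + 4) - 1
        = (Real.log (((k + 1 : ℕ) : ℝ) + 4) - Real.log ((k : ℝ) + 4)) / Real.log ((k : ℝ) + 4) := by
          field_simp
      _ ≤ (1 / ((k : ℝ) + 1)) / Real.log ((k : ℝ) + 4) := by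
          gcongr
          refine h2.trans ?_
          rw [div_sub_one (by positivity), div_le_div_iff₀ (by positivity) (by positivity)]
          push_cast
          linarith
      _ = _ := by rw [div_div, one_div]
  refine tendsto_atTop_mono hle (tendsto_atTop_add_const_right _ _ ?_)
  exact Real.tendsto_log_atTop.comp (Real.tendsto_log_atTop.comp
    (tendsto_atTop_add_const_right _ _ tendsto_natCast_atTop_atTop))

/-- Divergence of the Carleman series of a sequence of order at most `D ^ n n! (log n) ^ n`. -/
theorem tendsto_sum_rpow_neg_inv_atTop {m : ℕ → ℝ} (hm : ∀ n, 0 < m n) (hA : 1 ≤ A) (hD : 0 < D)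
    (hbound : ∀ n : ℕ, m n ≤
      A * (D ^ (2 * n) * ((2 * n).factorial * Real.log ((2 * n : ℕ) + 3) ^ (2 * n)))) :
    Tendsto (fun N : ℕ => ∑ n ∈ Finset.Icc 1 N, m n ^ (-(1 : ℝ) / (2 * n))) atTop atTop := by
  have hle (N : ℕ) : (A * D * 4)⁻¹ *
      ∑ k ∈ Finset.range N, (((k : ℝ) + 1) * Real.log ((k : ℝ) + 4))⁻¹ ≤
      ∑ n ∈ Finset.Icc 1 N, m n ^ (-(1 : ℝ) / (2 * n)) := by
    rw [← Finset.Ico_add_one_right_eq_Icc, Finset.sum_Ico_eq_sum_range, Finset.mul_sum,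
      Nat.add_sub_cancel]
    refine Finset.sum_le_sum fun k _ => ?_
    rw [add_comm 1 k]
    set n := k + 1 with hn
    have hk := k.cast_nonneg (α := ℝ)
    have hL4 : 0 < Real.log ((k : ℝ) + 4) := Real.log_pos (by linarith)
    have hL := one_le_log_natCast_add_three (2 * n)
    have hlog : Real.log ((2 * n : ℕ) + 3) ≤ 2 * Real.log ((k : ℝ) + 4) := by
      rw [← Real.log_rpow (by positivity)]
      refine Real.log_le_log (by positivity) ?_
      rw [Real.rpow_two, hn]
      push_cast
      nlinarith
    set Z := A * D * 4 * (((k : ℝ) + 1) * Real.log ((k : ℝ) + 4)) with hZ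
    have hZ0 : 0 < Z := by positivity
    have hmZ : m n ≤ Z ^ (2 * n) := by
      refine (hbound n).trans ?_
      have h1 : ((2 * n).factorial : ℝ) ≤ ((2 * n : ℕ) : ℝ) ^ (2 * n) := by
        exact_mod_cast Nat.factorial_le_pow (2 * n)
      have h2 : A ≤ A ^ (2 * n) := le_self_pow₀ hA (by omega)
      calc A * (D ^ (2 * n) * ((2 * n).factorial * Real.log ((2 * n : ℕ) + 3) ^ (2 * n)))
          ≤ A ^ (2 * n) * (D ^ (2 * n) * (((2 * n : ℕ) : ℝ) ^ (2 * n) *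
              (2 * Real.log ((k : ℝ) + 4)) ^ (2 * n))) := by gcongr
        _ = Z ^ (2 * n) := by
            rw [← mul_pow, ← mul_pow, ← mul_pow, hZ, hn]
            push_cast
            ring_nf
    have hn0 : (n : ℝ) ≠ 0 := by positivity
    calc (A * D * 4)⁻¹ * (((k : ℝ) + 1) * Real.log ((k : ℝ) + 4))⁻¹ = Z⁻¹ :=
          (mul_inv _ _).symm
      _ = (Z ^ (2 * n)) ^ (-(1 : ℝ) / (2 * n)) := by
          rw [← Real.rpow_natCast, ← Real.rpow_mul hZ0.le, ← Real.rpow_neg_one]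
          congr 1
          push_cast
          field_simp
      _ ≤ m n ^ (-(1 : ℝ) / (2 * n)) :=
          Real.rpow_le_rpow_of_nonpos (hm n) hmZ
            (div_nonpos_of_nonpos_of_nonneg (by norm_num) (by positivity))
  exact tendsto_atTop_mono hle (tendsto_sum_inv_mul_log_atTop.const_mul_atTop (by positivity))

/-- Two finite measures with the same moments coincide if the moments are of order at most
`D ^ n n! (log n) ^ n`. -/
theorem eq_of_integral_pow_eq_of_le_log {μ ν : Measure ℝ} [IsFiniteMeasure μ] [IsFiniteMeasure ν]
    (hμ : ∀ n : ℕ, Integrable (fun x => x ^ n) μ) (hν : ∀ n : ℕ, Integrable (fun x => x ^ n) ν)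
    (heq : ∀ n : ℕ, ∫ x, x ^ n ∂μ = ∫ x, x ^ n ∂ν) (hA : 0 ≤ A) (hD : 0 < D)
    (hbound : ∀ n : ℕ, ∫ x, x ^ (2 * n) ∂μ ≤
      A * (D ^ (2 * n) * ((2 * n).factorial * Real.log ((2 * n : ℕ) + 3) ^ (2 * n)))) :
    μ = ν := by
  have hpos (k : ℕ) : 0 < Real.log ((k : ℝ) + 4) :=
    Real.log_pos (by linarith [k.cast_nonneg (α := ℝ)])
  have hmono (k : ℕ) : Real.log ((k : ℝ) + 4) ≤ Real.log (((k + 1 : ℕ) : ℝ) + 4) :=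
    Real.log_le_log (by positivity) (by push_cast; linarith)
  refine eq_of_integral_pow_eq (A := A) (C := 4)
    (r := fun k => D * Real.exp 1 * ((k + 1) * Real.log ((k : ℝ) + 4))) hμ hν heq
    (monotone_nat_of_le_succ fun k => ?_) (fun k => ?_) (fun k => ?_) ?_
    fun n => (hbound n).trans (mul_le_mul_of_nonneg_left (pow_mul_factorial_mul_log_pow_le hD _) hA)
  · have := hpos k
    have := hmono k
    gcongr
    simp
  · have := hpos k
    positivity
  · have := hpos k
    have h1 : Real.log (((k + 1 : ℕ) : ℝ) + 4) ≤ 2 * Real.log ((k : ℝ) + 4) := by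
      rw [← Real.log_rpow (by positivity)]
      refine Real.log_le_log (by positivity) ?_
      rw [Real.rpow_two]
      push_cast
      nlinarith [k.cast_nonneg (α := ℝ)]
    calc D * Real.exp 1 * (((k + 1 : ℕ) + 1) * Real.log (((k + 1 : ℕ) : ℝ) + 4))
        ≤ D * Real.exp 1 * ((2 * (k + 1)) * (2 * Real.log ((k : ℝ) + 4))) := by
          refine mul_le_mul_of_nonneg_left (mul_le_mul ?_ h1 (hpos _).le (by positivity))
            (by positivity)
          push_cast
          linarith [k.cast_nonneg (α := ℝ)]
      _ = _ := by ring
  · simp_rw [mul_inv (D * Real.exp 1)]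
    rw [summable_mul_left_iff (by positivity)]
    exact (not_summable_iff_tendsto_nat_atTop_of_nonneg fun k => by
      have := hpos k; positivity).2 tendsto_sum_inv_mul_log_atTop

end LogRate

section Symmetrization

variable {μ ν : Measure ℝ} {A D : ℝ}

/-- Twice the law of `ε √Y`, where `Y` has law `ν` and `ε` is an independent random sign. -/
noncomputable def sqrtSymmetrization (ν : Measure ℝ) : Measure ℝ :=
  ν.map Real.sqrt + ν.map fun x => -√x

instance [IsFiniteMeasure ν] : IsFiniteMeasure (sqrtSymmetrization ν) := by
  unfold sqrtSymmetrization; infer_instance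

theorem integrable_sqrt_pow [IsFiniteMeasure ν] (hν : ∀ n : ℕ, Integrable (fun x => x ^ n) ν)
    (n : ℕ) : Integrable (fun x => √x ^ n) ν := by
  refine ((integrable_const (1 : ℝ)).add (hν n).norm).mono' (by fun_prop) (.of_forall fun x => ?_)
  have h0 : 0 ≤ ‖x ^ n‖ := norm_nonneg _
  rw [Real.norm_of_nonneg (by positivity), Pi.add_apply]
  rcases le_total x 1 with hx | hx
  · have := pow_le_one₀ (n := n) (Real.sqrt_nonneg x) (Real.sqrt_le_one.2 hx)
    linarith
  · have : √x ^ n ≤ x ^ n :=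
      pow_le_pow_left₀ (Real.sqrt_nonneg x) (Real.sqrt_le_iff.2 ⟨by linarith, by nlinarith⟩) n
    linarith [Real.le_norm_self (x ^ n)]

theorem integrable_pow_sqrtSymmetrization [IsFiniteMeasure ν]
    (hν : ∀ n : ℕ, Integrable (fun x => x ^ n) ν) (n : ℕ) :
    Integrable (fun x => x ^ n) (sqrtSymmetrization ν) := by
  refine Integrable.add_measure ?_ ?_
  · rw [integrable_map_measure (by fun_prop) (by fun_prop)]
    exact integrable_sqrt_pow hν n
  · rw [integrable_map_measure (by fun_prop) (by fun_prop)]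
    have := (integrable_sqrt_pow hν n).const_mul ((-1) ^ n)
    simp_rw [← neg_pow] at this
    exact this

theorem integral_pow_sqrtSymmetrization [IsFiniteMeasure ν]
    (hν : ∀ n : ℕ, Integrable (fun x => x ^ n) ν) (n : ℕ) :
    ∫ x, x ^ n ∂sqrtSymmetrization ν = (1 + (-1) ^ n) * ∫ x, √x ^ n ∂ν := by
  have h := integrable_pow_sqrtSymmetrization hν n
  rw [sqrtSymmetrization, integrable_add_measure] at h
  rw [sqrtSymmetrization, integral_add_measure h.1 h.2, integral_map (by fun_prop) (by fun_prop),
    integral_map (by fun_prop) (by fun_prop)]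
  simp_rw [neg_pow √_ n]
  rw [integral_const_mul]
  ring

theorem integral_sqrt_pow_two_mul (hν0 : ν (Iio 0) = 0) (n : ℕ) :
    ∫ x, √x ^ (2 * n) ∂ν = ∫ x, x ^ n ∂ν := by
  refine integral_congr_ae ?_
  have : ∀ᵐ x ∂ν, x ∉ Iio 0 := measure_eq_zero_iff_ae_notMem.1 hν0
  filter_upwards [this] with x hx
  rw [pow_mul, Real.sq_sqrt (not_lt.1 hx)]

theorem map_sq_sqrtSymmetrization (hν0 : ν (Iio 0) = 0) :
    (sqrtSymmetrization ν).map (fun x => x ^ 2) = (2 : ENNReal) • ν := by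
  have hid : ν.map (fun x => √x ^ 2) = ν := by
    conv_rhs => rw [← Measure.map_id (μ := ν)]
    refine Measure.map_congr ?_
    have : ∀ᵐ x ∂ν, x ∉ Iio 0 := measure_eq_zero_iff_ae_notMem.1 hν0
    filter_upwards [this] with x hx
    exact Real.sq_sqrt (not_lt.1 hx)
  rw [sqrtSymmetrization, Measure.map_add _ _ (by fun_prop), Measure.map_map (by fun_prop)
    (by fun_prop), Measure.map_map (by fun_prop) (by fun_prop)]
  simp only [Function.comp_def, neg_sq, hid, two_smul]

/-- Two finite measures on `[0, ∞)` with the same moments coincide if the moments are of order at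
most `D ^ n (2 n)! (log n) ^ (2 n)`. -/
theorem eq_of_integral_pow_eq_of_nonneg [IsFiniteMeasure μ] [IsFiniteMeasure ν]
    (hμ0 : μ (Iio 0) = 0) (hν0 : ν (Iio 0) = 0)
    (hμ : ∀ n : ℕ, Integrable (fun x => x ^ n) μ) (hν : ∀ n : ℕ, Integrable (fun x => x ^ n) ν)
    (heq : ∀ n : ℕ, ∫ x, x ^ n ∂μ = ∫ x, x ^ n ∂ν) (hA : 0 ≤ A) (hD : 0 < D)
    (hbound : ∀ n : ℕ, ∫ x, x ^ n ∂μ ≤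
      A * (D ^ (2 * n) * ((2 * n).factorial * Real.log ((2 * n : ℕ) + 3) ^ (2 * n)))) :
    μ = ν := by
  have hsymm : sqrtSymmetrization μ = sqrtSymmetrization ν := by
    refine eq_of_integral_pow_eq_of_le_log (A := 2 * A) (integrable_pow_sqrtSymmetrization hμ)
      (integrable_pow_sqrtSymmetrization hν) (fun n => ?_) (by positivity) hD fun n => ?_
    · rw [integral_pow_sqrtSymmetrization hμ, integral_pow_sqrtSymmetrization hν]
      rcases Nat.even_or_odd' n with ⟨k, rfl | rfl⟩
      · rw [integral_sqrt_pow_two_mul hμ0, integral_sqrt_pow_two_mul hν0, heq]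
      · simp [pow_succ]
    · rw [integral_pow_sqrtSymmetrization hμ, integral_sqrt_pow_two_mul hμ0,
        (even_two_mul n).neg_one_pow, mul_assoc 2, one_add_one_eq_two]
      exact mul_le_mul_of_nonneg_left (hbound n) zero_le_two
  have h2 := map_sq_sqrtSymmetrization hμ0
  rw [hsymm, map_sq_sqrtSymmetrization hν0] at h2
  ext s hs
  have := congrArg (fun κ : Measure ℝ => κ s) h2
  simp only [Measure.smul_apply, smul_eq_mul] at this
  exact ((ENNReal.mul_right_inj (by simp) (by simp)).1 this).symm

end Symmetrization

section RatioCondition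

variable {μ : Measure ℝ} {f : ℝ → ℝ} {x₀ a α : ℝ}

theorem restrict_eq_withDensity_of_subset {s t : Set ℝ} (hst : s ⊆ t) (hs : MeasurableSet s)
    (h : μ.restrict t = (volume.restrict t).withDensity fun x => ENNReal.ofReal (f x)) :
    μ.restrict s = (volume.restrict s).withDensity fun x => ENNReal.ofReal (f x) := by
  rw [← Measure.restrict_restrict_of_subset hst, h, restrict_withDensity hs,
    Measure.restrict_restrict_of_subset hst]

theorem map_neg_restrict_Ici_eq_withDensity
    (h : μ.restrict (Iic (-x₀)) =
      (volume.restrict (Iic (-x₀))).withDensity fun x => ENNReal.ofReal (f x)) :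
    (μ.map Neg.neg).restrict (Ici x₀) =
      (volume.restrict (Ici x₀)).withDensity fun x => ENNReal.ofReal (f (-x)) := by
  have hpre : Neg.neg ⁻¹' Ici x₀ = Iic (-x₀) := by
    ext x
    simp
  ext s hs
  rw [Measure.restrict_map measurable_neg measurableSet_Ici, hpre, h,
    Measure.map_apply measurable_neg hs, withDensity_apply _ (measurable_neg hs),
    withDensity_apply _ hs, Measure.restrict_restrict (measurable_neg hs),
    Measure.restrict_restrict hs, ← hpre, ← preimage_inter]
  have := (Measure.measurePreserving_neg (volume : Measure ℝ)).setLIntegral_comp_preimage_emb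
    (MeasurableEquiv.neg ℝ).measurableEmbedding (fun x => ENNReal.ofReal (f (-x))) (s ∩ Ici x₀)
  simpa using this

theorem exists_ratio_le_of_limsup_lt_one
    (hf_pos : ∀ x ∈ (Ioo (-x₀) x₀)ᶜ, 0 < f x)
    (hlimsup : Filter.limsup
        (fun x => ENNReal.ofReal (f (x + a * sgn x * (Real.log |x|) ^ α) / f x))
        (atBot ⊔ atTop) < 1) :
    ∃ ρ : ℝ, 0 ≤ ρ ∧ ρ < 1 ∧
      (∀ᶠ x in atTop, 0 < f x ∧ f (x + a * Real.log x ^ α) ≤ ρ * f x) ∧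
      ∀ᶠ x in atTop, 0 < f (-x) ∧ f (-(x + a * Real.log x ^ α)) ≤ ρ * f (-x) := by
  obtain ⟨b, hb, hb1⟩ := exists_between hlimsup
  have hev := Filter.eventually_lt_of_limsup_lt hb
  rw [eventually_sup] at hev
  have hbtop : b ≠ ⊤ := (hb1.trans ENNReal.one_lt_top).ne
  have key {x y : ℝ} (hx : 0 < f x) (h : ENNReal.ofReal (f y / f x) < b) :
      f y ≤ b.toReal * f x := by
    rw [← div_le_iff₀ hx]
    exact (ENNReal.ofReal_le_iff_le_toReal hbtop).1 h.le
  refine ⟨b.toReal, ENNReal.toReal_nonneg, by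
    simpa using (ENNReal.toReal_lt_toReal hbtop ENNReal.one_ne_top).2 hb1, ?_, ?_⟩
  · filter_upwards [hev.2, eventually_ge_atTop x₀, eventually_ge_atTop 0] with x hx hx0 hx1
    have hfx := hf_pos x fun h => absurd h.2 (not_lt.2 hx0)
    refine ⟨hfx, key hfx ?_⟩
    simpa [sgn, hx1, abs_of_nonneg hx1] using hx
  · filter_upwards [tendsto_neg_atTop_atBot.eventually hev.1, eventually_ge_atTop x₀,
      eventually_gt_atTop 0] with x hx hx0 hx1
    have hfx := hf_pos (-x) fun h => absurd h.1 (not_lt.2 (neg_le_neg hx0))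
    refine ⟨hfx, key hfx ?_⟩
    have e : -(x + a * Real.log x ^ α) = -x + a * sgn (-x) * Real.log |-x| ^ α := by
      rw [sgn, if_neg (by linarith), abs_neg, abs_of_pos hx1]
      ring
    rwa [e]

/-- Under the ratio condition, the even moments are of order at most `D ^ n n! (log n) ^ n`. -/
theorem exists_integral_pow_two_mul_le [IsFiniteMeasure μ]
    (ha : 0 < a) (hα : α ∈ Icc (0 : ℝ) 1)
    (hmom : ∀ n : ℕ, Integrable (fun x => x ^ n) μ) (hf_meas : Measurable f)
    (hf_ac : μ.restrict ((Ioo (-x₀) x₀)ᶜ) =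
      (volume.restrict ((Ioo (-x₀) x₀)ᶜ)).withDensity (fun x => ENNReal.ofReal (f x)))
    (hf_pos : ∀ x ∈ (Ioo (-x₀) x₀)ᶜ, 0 < f x)
    (hlimsup : Filter.limsup
        (fun x => ENNReal.ofReal (f (x + a * sgn x * (Real.log |x|) ^ α) / f x))
        (atBot ⊔ atTop) < 1) :
    ∃ A D : ℝ, 1 ≤ A ∧ 0 < D ∧ ∀ n : ℕ, ∫ x, x ^ (2 * n) ∂μ ≤
      A * (D ^ (2 * n) * ((2 * n).factorial * Real.log ((2 * n : ℕ) + 3) ^ (2 * n))) := by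
  obtain ⟨ρ, hρ, hρ1, hright, hleft⟩ := exists_ratio_le_of_limsup_lt_one hf_pos hlimsup
  have hIci : Ici x₀ ⊆ (Ioo (-x₀) x₀)ᶜ := fun x hx h => absurd h.2 (not_lt.2 hx)
  have hIic : Iic (-x₀) ⊆ (Ioo (-x₀) x₀)ᶜ := fun x hx h => absurd h.1 (not_lt.2 hx)
  obtain ⟨A₁, D₁, hA₁, hD₁, h₁⟩ := exists_setLIntegral_pow_le hf_meas ha hα hρ hρ1
    (restrict_eq_withDensity_of_subset hIci measurableSet_Ici hf_ac) hright
  obtain ⟨A₂, D₂, hA₂, hD₂, h₂⟩ := exists_setLIntegral_pow_le (f := fun x => f (-x))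
    (hf_meas.comp measurable_neg) ha hα hρ hρ1 (map_neg_restrict_Ici_eq_withDensity
      (restrict_eq_withDensity_of_subset hIic measurableSet_Iic hf_ac)) hleft
  refine ⟨A₁ + A₂ + 1, max D₁ D₂, by linarith, lt_max_of_lt_left (by linarith), fun n => ?_⟩
  set D := max D₁ D₂ with hD
  set q := ((2 * n).factorial : ℝ) * Real.log ((2 * n : ℕ) + 3) ^ (2 * n) with hq
  have hq1 : 1 ≤ q := one_le_factorial_mul_log_pow (2 * n)
  have hD0 : 0 < D := lt_max_of_lt_left (by linarith)
  have hneg : ∫⁻ x in Ici 0, ENNReal.ofReal (x ^ (2 * n)) ∂(μ.map Neg.neg) =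
      ∫⁻ x in Iic 0, ENNReal.ofReal (x ^ (2 * n)) ∂μ := by
    rw [setLIntegral_map measurableSet_Ici (by fun_prop) measurable_neg]
    simp [(even_two_mul n).neg_pow]
  have hsub : (univ : Set ℝ) ⊆ Ici 0 ∪ Iic 0 := fun x _ => le_total 0 x
  rw [integral_eq_lintegral_of_nonneg_ae (.of_forall fun x => (even_two_mul n).pow_nonneg x)
    (hmom _).aestronglyMeasurable]
  refine ENNReal.toReal_le_of_le_ofReal (by positivity) ?_
  calc ∫⁻ x, ENNReal.ofReal (x ^ (2 * n)) ∂μ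
      ≤ (∫⁻ x in Ici 0, ENNReal.ofReal (x ^ (2 * n)) ∂μ) +
          ∫⁻ x in Iic 0, ENNReal.ofReal (x ^ (2 * n)) ∂μ := by
        rw [← setLIntegral_univ]
        exact (lintegral_mono_set hsub).trans (lintegral_union_le _ _ _)
    _ ≤ ENNReal.ofReal (A₁ * (D₁ ^ (2 * n) * q)) + ENNReal.ofReal (A₂ * (D₂ ^ (2 * n) * q)) :=
        add_le_add (h₁ _) (hneg ▸ h₂ _)
    _ = ENNReal.ofReal (A₁ * (D₁ ^ (2 * n) * q) + A₂ * (D₂ ^ (2 * n) * q)) :=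
        (ENNReal.ofReal_add (by positivity) (by positivity)).symm
    _ ≤ _ := by
        refine ENNReal.ofReal_le_ofReal ?_
        calc A₁ * (D₁ ^ (2 * n) * q) + A₂ * (D₂ ^ (2 * n) * q)
            ≤ A₁ * (D ^ (2 * n) * q) + A₂ * (D ^ (2 * n) * q) := by
              gcongr
              · exact le_max_left _ _
              · exact le_max_right _ _
          _ ≤ (A₁ + A₂ + 1) * (D ^ (2 * n) * q) := by
              have : 0 ≤ D ^ (2 * n) * q := by positivity
              linarith

theorem integral_pow_two_mul_pos (hx₀ : 0 < x₀)
    (hmom : ∀ n : ℕ, Integrable (fun x => x ^ n) μ) (hf_meas : Measurable f)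
    (hf_ac : μ.restrict ((Ioo (-x₀) x₀)ᶜ) =
      (volume.restrict ((Ioo (-x₀) x₀)ᶜ)).withDensity (fun x => ENNReal.ofReal (f x)))
    (hf_pos : ∀ x ∈ (Ioo (-x₀) x₀)ᶜ, 0 < f x) (n : ℕ) : 0 < ∫ x, x ^ (2 * n) ∂μ := by
  rw [integral_pos_iff_support_of_nonneg (fun x => (even_two_mul n).pow_nonneg x) (hmom _)]
  have hIci : Ici x₀ ⊆ (Ioo (-x₀) x₀)ᶜ := fun x hx h => absurd h.2 (not_lt.2 hx)
  have hsub : Ici x₀ ⊆ Function.support fun x : ℝ => x ^ (2 * n) := fun x hx =>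
    pow_ne_zero _ (hx₀.trans_le hx).ne'
  refine lt_of_lt_of_le ?_ (measure_mono hsub)
  have h := congrArg (fun κ : Measure ℝ => κ univ)
    (restrict_eq_withDensity_of_subset hIci measurableSet_Ici hf_ac)
  simp only [Measure.restrict_apply_univ, withDensity_apply _ MeasurableSet.univ,
    Measure.restrict_univ] at h
  rw [h, setLIntegral_pos_iff (by fun_prop)]
  have : Ici x₀ ⊆ (Function.support fun x => ENNReal.ofReal (f x)) ∩ Ici x₀ := fun x hx =>
    ⟨by simpa using hf_pos x (hIci hx), hx⟩
  exact lt_of_lt_of_le (by simp) (measure_mono this)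

end RatioCondition

/-- Corollary 1: if `limsup_{|x|→∞} f(x + a sign(x) (log|x|)^α)/f(x) < 1` with
`a > 0`, `α ∈ [0,1]`, then `∑ m_{2n}^{-1/(2n)} = ∞`, `X` is M-det on `ℝ`, and
`X²`, `|X|` are M-det on `ℝ₊`. -/
theorem corollary1
    (x₀ : ℝ) (hx₀ : 1 < x₀)
    (a α : ℝ) (ha : 0 < a) (hα : α ∈ Icc (0 : ℝ) 1)
    (μ : Measure ℝ) [IsProbabilityMeasure μ]
    (hmom : ∀ n : ℕ, Integrable (fun x => x ^ n) μ)
    (f : ℝ → ℝ) (hf_meas : Measurable f)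
    (hf_ac : μ.restrict ((Ioo (-x₀) x₀)ᶜ) =
      (volume.restrict ((Ioo (-x₀) x₀)ᶜ)).withDensity (fun x => ENNReal.ofReal (f x)))
    (hf_pos : ∀ x ∈ (Ioo (-x₀) x₀)ᶜ, 0 < f x)
    (hlimsup : Filter.limsup
        (fun x => ENNReal.ofReal (f (x + a * sgn x * (Real.log |x|) ^ α) / f x))
        (atBot ⊔ atTop) < 1) :
    Tendsto (fun N : ℕ => ∑ n ∈ Finset.Icc 1 N,
        (∫ x, x ^ (2 * n) ∂μ) ^ (-(1 : ℝ) / (2 * n))) atTop atTop ∧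
    IsMomentDetOnReal μ ∧
    IsMomentDetOnNonneg (μ.map (fun x => x ^ 2)) ∧
    IsMomentDetOnNonneg (μ.map (fun x => |x|)) := by
  obtain ⟨A, D, hA, hD, hbound⟩ := exists_integral_pow_two_mul_le ha hα hmom hf_meas hf_ac
    hf_pos hlimsup
  have hA0 : 0 ≤ A := by linarith
  have hext {κ ν : Measure ℝ} [IsProbabilityMeasure κ] [IsProbabilityMeasure ν]
      (h : ∀ n : ℕ, 0 < n → Integrable (fun x => x ^ n) ν ∧ ∫ x, x ^ n ∂ν = ∫ x, x ^ n ∂κ)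
      (n : ℕ) : Integrable (fun x => x ^ n) ν ∧ ∫ x, x ^ n ∂κ = ∫ x, x ^ n ∂ν := by
    rcases n.eq_zero_or_pos with rfl | hn
    · simp
    · exact ⟨(h n hn).1, (h n hn).2.symm⟩
  refine ⟨tendsto_sum_rpow_neg_inv_atTop
    (integral_pow_two_mul_pos (by linarith) hmom hf_meas hf_ac hf_pos) hA hD hbound, ?_, ?_, ?_⟩
  · intro ν _ h
    exact (eq_of_integral_pow_eq_of_le_log hmom (fun n => (hext h n).1) (fun n => (hext h n).2)
      hA0 hD hbound).symm
  · intro ν _ hν0 h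
    have hm : Measurable fun x : ℝ => x ^ 2 := by fun_prop
    have : IsProbabilityMeasure (μ.map fun x => x ^ 2) :=
      Measure.isProbabilityMeasure_map hm.aemeasurable
    refine (eq_of_integral_pow_eq_of_nonneg ?_ hν0 (fun n => ?_) (fun n => (hext h n).1)
      (fun n => (hext h n).2) hA0 hD fun n => ?_).symm
    · rw [Measure.map_apply hm measurableSet_Iio,
        show (fun x : ℝ => x ^ 2) ⁻¹' Iio 0 = ∅ from
          eq_empty_of_forall_notMem fun x hx => (sq_nonneg x).not_gt hx, measure_empty]
    · rw [integrable_map_measure (by fun_prop) hm.aemeasurable]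
      simpa [Function.comp_def, ← pow_mul] using hmom (2 * n)
    · rw [integral_map hm.aemeasurable (by fun_prop)]
      simpa only [← pow_mul] using hbound n
  · intro ν _ _ h
    have hm : Measurable fun x : ℝ => |x| := by fun_prop
    have : IsProbabilityMeasure (μ.map fun x => |x|) :=
      Measure.isProbabilityMeasure_map hm.aemeasurable
    refine (eq_of_integral_pow_eq_of_le_log (fun n => ?_) (fun n => (hext h n).1)
      (fun n => (hext h n).2) hA0 hD fun n => ?_).symm
    · rw [integrable_map_measure (by fun_prop) hm.aemeasurable]
      simpa [Function.comp_def] using (hmom n).norm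
    · rw [integral_map hm.aemeasurable (by fun_prop)]
      simpa only [(even_two_mul n).pow_abs] using hbound n
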